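/- Let ε, Δt > 0 and μ ∈ ℝ. For every continuous 2π-periodic function W : ℝ → ℂ², there exists a unique C¹, 2π-periodic function V : ℝ → ℂ² such that Q(V)(τ) = W(τ) for all τ ∈ ℝ, where Q(V)(τ) := V(τ) + (Δt/ε) iμ A(τ) V(τ) + (Δt/ε²) V′(τ). In other words, the operator Q is invertible on the space of 2π-periodic functions, and by the a priori estimate its inverse satisfies sup_τ ‖Q^{−1}(W)(τ)‖ ≤ sup_τ ‖W(τ)‖. -/

import Mathlib

open Real Complex Matrix

/-- `A(τ) = [[0, e^{2iτ}],[e^{−2iτ}, 0]]`. -/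
noncomputable def Amat (τ : ℝ) : Matrix (Fin 2) (Fin 2) ℂ :=
  !![0, Complex.exp (2 * Complex.I * τ); Complex.exp (-2 * Complex.I * τ), 0]

/-- The Euclidean norm on `ℂ²`. -/
noncomputable def enorm2 (v : Fin 2 → ℂ) : ℝ :=
  Real.sqrt (Complex.normSq (v 0) + Complex.normSq (v 1))

/-- The operator `Q(V)(τ) = V(τ) + (Δt/ε) iμ A(τ) V(τ) + (Δt/ε²) V′(τ)`. -/
noncomputable def Qop (ε Δt μ : ℝ) (V : ℝ → Fin 2 → ℂ) (τ : ℝ) : Fin 2 → ℂ :=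
  V τ + ((Δt / ε : ℝ) : ℂ) • (Complex.I * (μ : ℂ)) • (Amat τ).mulVec (V τ) +
    ((Δt / ε ^ 2 : ℝ) : ℂ) • deriv V τ

/-- For `Re z < 0`, the scalar equation `u' = z u + f` with `T`-periodic forcing has a
`T`-periodic solution. -/
theorem exists_periodic_hasDerivAt {T : ℝ} (hT : 0 < T) {z : ℂ} (hz : z.re < 0)
    {f : ℝ → ℂ} (hf : Continuous f) (hper : Function.Periodic f T) :
    ∃ u : ℝ → ℂ, Function.Periodic u T ∧ ∀ t, HasDerivAt u (z * u t + f t) t := by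
  have hne : 1 - Complex.exp (z * T) ≠ 0 := by
    intro h
    have h1 : ‖Complex.exp (z * T)‖ = 1 := by
      rw [← sub_eq_zero.mp h, norm_one]
    rw [Complex.norm_exp, Real.exp_eq_one_iff] at h1
    simp only [Complex.mul_re, Complex.ofReal_re, Complex.ofReal_im, mul_zero, sub_zero] at h1
    nlinarith
  set g : ℝ → ℂ := fun s => Complex.exp (-(z * s)) * f s with hg
  have hgc : Continuous g := by fun_prop
  have hgT : ∀ s, g (s + T) = Complex.exp (-(z * T)) * g s := by
    intro s
    simp only [hg, hper s]
    rw [← mul_assoc, ← Complex.exp_add]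
    push_cast
    ring_nf
  have hcancel : ∀ x : ℂ, Complex.exp x * Complex.exp (-x) = 1 := fun x => by
    rw [← Complex.exp_add, add_neg_cancel, Complex.exp_zero]
  refine ⟨fun t => (1 - Complex.exp (z * T))⁻¹ *
    (Complex.exp (z * t) * ∫ s in (t - T)..t, g s), ?_, ?_⟩
  · intro t
    have h1 : ∫ s in (t + T - T)..(t + T), g s
        = Complex.exp (-(z * T)) * ∫ s in (t - T)..t, g s := by
      rw [← intervalIntegral.integral_const_mul]
      simp_rw [← hgT]
      rw [intervalIntegral.integral_comp_add_right]
      congr 1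
      ring
    simp only [h1]
    push_cast
    rw [mul_add, Complex.exp_add]
    linear_combination (1 - Complex.exp (z * T))⁻¹ * Complex.exp (z * t) *
      (∫ s in (t - T)..t, g s) * hcancel (z * T)
  · intro t
    have hG : ∀ x, HasDerivAt (fun x => ∫ s in (0 : ℝ)..x, g s) (g x) x := fun x =>
      intervalIntegral.integral_hasDerivAt_right (hgc.intervalIntegrable _ _)
        (hgc.stronglyMeasurableAtFilter _ _) hgc.continuousAt
    have h2 : HasDerivAt (fun x => ∫ s in (x - T)..x, g s) (g t - g (t - T)) t := by
      have h3 := (hG t).sub ((hG (t - T)).comp_sub_const t T)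
      refine h3.congr_of_eventuallyEq (Filter.Eventually.of_forall fun x => ?_)
      exact (intervalIntegral.integral_interval_sub_left (hgc.intervalIntegrable _ _)
        (hgc.intervalIntegrable _ _)).symm
    have h4 : HasDerivAt (fun x : ℝ => Complex.exp (z * x)) (Complex.exp (z * t) * z) t := by
      simpa using ((Complex.ofRealCLM.hasDerivAt (x := t)).const_mul z).cexp
    have h5 := (h4.mul h2).const_mul (1 - Complex.exp (z * T))⁻¹
    refine h5.congr_deriv ?_
    symm
    beta_reduce
    have h6 : g (t - T) = Complex.exp (z * T) * g t := by
      have h := hgT (t - T)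
      rw [sub_add_cancel] at h
      rw [h, ← mul_assoc, hcancel, one_mul]
    have h7 : Complex.exp (z * t) * g t = f t := by
      simp only [hg]
      rw [← mul_assoc, hcancel, one_mul]
    rw [h6]
    have h8 := inv_mul_cancel₀ hne
    linear_combination (-f t) * h8 -
      (1 - Complex.exp (z * T))⁻¹ * (1 - Complex.exp (z * T)) * h7

/-- The periodically forced constant-coefficient system with matrix
`-c - i [[1, k], [k, -1]]` has a periodic solution. -/
theorem exists_periodic_hasDerivAt_system {T : ℝ} (hT : 0 < T) {c : ℝ} (hc : 0 < c) (k : ℝ)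
    {f g : ℝ → ℂ} (hf : Continuous f) (hg : Continuous g)
    (hfT : Function.Periodic f T) (hgT : Function.Periodic g T) :
    ∃ u v : ℝ → ℂ, Function.Periodic u T ∧ Function.Periodic v T ∧
      (∀ t, HasDerivAt u (-c * u t - I * (u t + k * v t) + f t) t) ∧
      (∀ t, HasDerivAt v (-c * v t - I * (k * u t - v t) + g t) t) := by
  set r : ℝ := √(1 + k ^ 2) with hr
  have hrpos : 0 < r := Real.sqrt_pos.mpr (by positivity)
  have hr0 : (r : ℂ) ≠ 0 := by exact_mod_cast hrpos.ne'
  have hr2 : (r : ℂ) ^ 2 = 1 + (k : ℂ) ^ 2 := by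
    exact_mod_cast Real.sq_sqrt (show (0 : ℝ) ≤ 1 + k ^ 2 by positivity)
  have hp : (-c - I * r : ℂ).re < 0 := by simpa using hc
  have hm : (-c + I * r : ℂ).re < 0 := by simpa using hc
  obtain ⟨p₀, hp₀T, hp₀⟩ := exists_periodic_hasDerivAt hT hp hf hfT
  obtain ⟨p₁, hp₁T, hp₁⟩ := exists_periodic_hasDerivAt hT hp hg hgT
  obtain ⟨m₀, hm₀T, hm₀⟩ := exists_periodic_hasDerivAt hT hm hf hfT
  obtain ⟨m₁, hm₁T, hm₁⟩ := exists_periodic_hasDerivAt hT hm hg hgT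
  refine ⟨fun t => ((p₀ t + m₀ t) + ((p₀ t - m₀ t) + k * (p₁ t - m₁ t)) / r) / 2,
    fun t => ((p₁ t + m₁ t) + (k * (p₀ t - m₀ t) - (p₁ t - m₁ t)) / r) / 2,
    fun t => ?_, fun t => ?_, fun t => ?_, fun t => ?_⟩
  · simp only [hp₀T t, hp₁T t, hm₀T t, hm₁T t]
  · simp only [hp₀T t, hp₁T t, hm₀T t, hm₁T t]
  · refine HasDerivAt.congr_deriv ((((hp₀ t).add (hm₀ t)).add ((((hp₀ t).sub (hm₀ t)).add
      (((hp₁ t).sub (hm₁ t)).const_mul (k : ℂ))).div_const (r : ℂ))).div_const 2) ?_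
    symm
    field_simp
    linear_combination I * (p₀ t - m₀ t) * hr2
  · refine HasDerivAt.congr_deriv ((((hp₁ t).add (hm₁ t)).add (((((hp₀ t).sub (hm₀ t)).const_mul (k : ℂ)).sub
      ((hp₁ t).sub (hm₁ t))).div_const (r : ℂ))).div_const 2) ?_
    symm
    field_simp
    linear_combination I * (p₁ t - m₁ t) * hr2

theorem Qop_apply_zero (ε Δt μ : ℝ) (V : ℝ → Fin 2 → ℂ) (τ : ℝ) :
    Qop ε Δt μ V τ 0 = V τ 0 + ((Δt / ε : ℝ) : ℂ) *
      (I * μ * (Complex.exp (2 * I * τ) * V τ 1)) + ((Δt / ε ^ 2 : ℝ) : ℂ) * deriv V τ 0 := by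
  simp [Qop, Amat, vecHead, vecTail]

theorem Qop_apply_one (ε Δt μ : ℝ) (V : ℝ → Fin 2 → ℂ) (τ : ℝ) :
    Qop ε Δt μ V τ 1 = V τ 1 + ((Δt / ε : ℝ) : ℂ) *
      (I * μ * (Complex.exp (-2 * I * τ) * V τ 0)) + ((Δt / ε ^ 2 : ℝ) : ℂ) * deriv V τ 1 := by
  simp [Qop, Amat, vecHead, vecTail]

theorem Qop_sub (ε Δt μ : ℝ) {V V' : ℝ → Fin 2 → ℂ} {τ : ℝ}
    (hV : DifferentiableAt ℝ V τ) (hV' : DifferentiableAt ℝ V' τ) :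
    Qop ε Δt μ (V - V') τ = Qop ε Δt μ V τ - Qop ε Δt μ V' τ := by
  simp only [Qop, deriv_sub hV hV', Pi.sub_apply, Matrix.mulVec_sub, smul_sub]
  abel

theorem continuous_enorm2 : Continuous enorm2 := by
  unfold enorm2
  have := Complex.continuous_normSq
  fun_prop

theorem enorm2_sq (v : Fin 2 → ℂ) :
    enorm2 v ^ 2 = Complex.normSq (v 0) + Complex.normSq (v 1) :=
  Real.sq_sqrt (add_nonneg (Complex.normSq_nonneg _) (Complex.normSq_nonneg _))

/-- Since `A` is Hermitian, the coupling term does not contribute to the energy balance. -/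
theorem enorm2_le_of_hasDerivAt_zero {ε Δt : ℝ} (μ : ℝ) {V : ℝ → Fin 2 → ℂ} {τ : ℝ}
    (hV : DifferentiableAt ℝ V τ)
    (h0 : HasDerivAt (fun t => enorm2 (V t) ^ 2) 0 τ) :
    enorm2 (V τ) ≤ enorm2 (Qop ε Δt μ V τ) := by
  have hd := hasDerivAt_pi.mp hV.hasDerivAt
  have hns : ∀ i, HasDerivAt (fun t => Complex.normSq (V t i))
      (2 * ((V τ i).re * (deriv V τ i).re + (V τ i).im * (deriv V τ i).im)) τ := by
    intro i
    have hre := Complex.reCLM.hasFDerivAt.comp_hasDerivAt τ (hd i)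
    have him := Complex.imCLM.hasFDerivAt.comp_hasDerivAt τ (hd i)
    simp only [Complex.normSq_apply]
    refine ((hre.mul hre).add (him.mul him)).congr_deriv ?_
    simp
    ring
  simp only [enorm2_sq] at h0
  have hE := h0.unique ((hns 0).add (hns 1))
  have hconj : Complex.exp (-2 * I * τ) = (starRingEnd ℂ) (Complex.exp (2 * I * τ)) := by
    rw [← Complex.exp_conj]
    simp [Complex.conj_ofNat]
  have e0 := Qop_apply_zero ε Δt μ V τ
  have e1 := Qop_apply_one ε Δt μ V τ
  rw [hconj] at e1
  have r0 := congrArg Complex.re e0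
  have i0 := congrArg Complex.im e0
  have r1 := congrArg Complex.re e1
  have i1 := congrArg Complex.im e1
  simp only [Complex.add_re, Complex.add_im, Complex.mul_re, Complex.mul_im, Complex.ofReal_re,
    Complex.ofReal_im, Complex.I_re, Complex.I_im, Complex.conj_re, Complex.conj_im]
    at r0 i0 r1 i1
  set w := Qop ε Δt μ V τ
  have hn : enorm2 (V τ) ^ 2 = (V τ 0).re * (w 0).re + (V τ 0).im * (w 0).im +
      ((V τ 1).re * (w 1).re + (V τ 1).im * (w 1).im) := by
    rw [enorm2_sq, Complex.normSq_apply, Complex.normSq_apply]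
    linear_combination (-(V τ 0).re) * r0 - (V τ 0).im * i0 - (V τ 1).re * r1 - (V τ 1).im * i1 +
      (Δt / ε ^ 2) / 2 * hE
  have hw := enorm2_sq w
  rw [Complex.normSq_apply, Complex.normSq_apply] at hw
  have hv := enorm2_sq (V τ)
  rw [Complex.normSq_apply, Complex.normSq_apply] at hv
  refine (sq_le_sq₀ (Real.sqrt_nonneg _) (Real.sqrt_nonneg _)).mp ?_
  change enorm2 (V τ) ^ 2 ≤ enorm2 w ^ 2
  nlinarith [sq_nonneg ((V τ 0).re - (w 0).re), sq_nonneg ((V τ 0).im - (w 0).im),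
    sq_nonneg ((V τ 1).re - (w 1).re), sq_nonneg ((V τ 1).im - (w 1).im)]

/-- The a priori estimate for `Q`. -/
theorem enorm2_le_sSup_enorm2_Qop {ε Δt μ : ℝ} {V W : ℝ → Fin 2 → ℂ} (hWc : Continuous W)
    (hV : Differentiable ℝ V) (hVper : Function.Periodic V (2 * π))
    (hQ : ∀ τ, Qop ε Δt μ V τ = W τ) (τ : ℝ) :
    enorm2 (V τ) ≤ sSup ((fun s => enorm2 (W s)) '' Set.Icc 0 (2 * π)) := by
  have hcV : Continuous fun s => enorm2 (V s) := continuous_enorm2.comp hV.continuous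
  obtain ⟨m, hm, hmax⟩ := isCompact_Icc.exists_isMaxOn
    (Set.nonempty_Icc.mpr Real.two_pi_pos.le) hcV.continuousOn
  have hglob : ∀ t, enorm2 (V t) ≤ enorm2 (V m) := by
    intro t
    obtain ⟨s, hs, hts⟩ := hVper.exists_mem_Ico₀ Real.two_pi_pos t
    rw [hts]
    exact hmax (Set.Ico_subset_Icc_self hs)
  have hdiff : DifferentiableAt ℝ (fun t => enorm2 (V t) ^ 2) m := by
    simp only [enorm2_sq, Complex.normSq_eq_norm_sq]
    have h := differentiable_pi.mp hV
    exact ((h 0 m).norm_sq ℝ).add ((h 1 m).norm_sq ℝ)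
  have hloc : IsLocalMax (fun t => enorm2 (V t) ^ 2) m :=
    Filter.Eventually.of_forall fun t => pow_le_pow_left₀ (Real.sqrt_nonneg _) (hglob t) 2
  have h0 := hdiff.hasDerivAt
  rw [hloc.deriv_eq_zero] at h0
  refine (hglob τ).trans ((enorm2_le_of_hasDerivAt_zero (ε := ε) (Δt := Δt) μ (hV m) h0).trans ?_)
  rw [hQ]
  exact le_csSup (isCompact_Icc.image (continuous_enorm2.comp hWc)).bddAbove
    (Set.mem_image_of_mem _ hm)

theorem eq_zero_of_enorm2_le_zero {v : Fin 2 → ℂ} (h : enorm2 v ≤ 0) : v = 0 := by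
  have h1 := enorm2_sq v
  rw [le_antisymm h (Real.sqrt_nonneg _)] at h1
  have n0 := Complex.normSq_nonneg (v 0)
  have n1 := Complex.normSq_nonneg (v 1)
  ext i
  fin_cases i
  · exact Complex.normSq_eq_zero.mp (show Complex.normSq (v 0) = 0 by linarith)
  · exact Complex.normSq_eq_zero.mp (show Complex.normSq (v 1) = 0 by linarith)

theorem exists_periodic_Qop_eq {ε Δt : ℝ} (hε : 0 < ε) (hΔt : 0 < Δt) (μ : ℝ)
    {W : ℝ → Fin 2 → ℂ} (hWc : Continuous W) (hWper : Function.Periodic W (2 * π)) :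
    ∃ V : ℝ → Fin 2 → ℂ,
      ContDiff ℝ 1 V ∧ Function.Periodic V (2 * π) ∧ ∀ τ : ℝ, Qop ε Δt μ V τ = W τ := by
  have hexp : Function.Periodic (fun t : ℝ => Complex.exp (I * t)) (2 * π) := fun t => by
    rw [Complex.exp_eq_exp_iff_exists_int]
    exact ⟨1, by push_cast; ring⟩
  have hexp' : Function.Periodic (fun t : ℝ => Complex.exp (-(I * t))) (2 * π) := fun t => by
    simp only [Complex.exp_neg, hexp t]
  have hW := continuous_pi_iff.mp hWc
  have hW0 := hW 0
  have hW1 := hW 1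
  set c : ℝ := ε ^ 2 / Δt with hc
  have hcpos : 0 < c := by positivity
  obtain ⟨u, v, huT, hvT, hu, hv⟩ := exists_periodic_hasDerivAt_system Real.two_pi_pos hcpos
    (ε * μ) (f := fun t => c * (Complex.exp (-(I * t)) * W t 0))
    (g := fun t => c * (Complex.exp (I * t) * W t 1)) (by fun_prop) (by fun_prop)
    (fun t => by simp only [hexp' t, hWper t]) (fun t => by simp only [hexp t, hWper t])
  have hcancel : ∀ x : ℂ, Complex.exp x * Complex.exp (-x) = 1 := fun x => by
    rw [← Complex.exp_add, add_neg_cancel, Complex.exp_zero]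
  have hu0 : Continuous u := continuous_iff_continuousAt.mpr fun t => (hu t).continuousAt
  have hv0 : Continuous v := continuous_iff_continuousAt.mpr fun t => (hv t).continuousAt
  have hE : ∀ t : ℝ, HasDerivAt (fun t : ℝ => Complex.exp (I * t))
      (Complex.exp (I * t) * I) t := fun t => by
    simpa using ((Complex.ofRealCLM.hasDerivAt (x := t)).const_mul I).cexp
  have hE' : ∀ t : ℝ, HasDerivAt (fun t : ℝ => Complex.exp (-(I * t)))
      (Complex.exp (-(I * t)) * -I) t := fun t => by
    simpa using ((Complex.ofRealCLM.hasDerivAt (x := t)).const_mul I).neg.cexp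
  set V : ℝ → Fin 2 → ℂ := fun t => ![Complex.exp (I * t) * u t, Complex.exp (-(I * t)) * v t]
    with hVdef
  set G : ℝ → Fin 2 → ℂ := fun t =>
    ![c * (W t 0 - Complex.exp (I * t) * u t) - I * (ε * μ) * (Complex.exp (I * t) * v t),
      c * (W t 1 - Complex.exp (-(I * t)) * v t)
        - I * (ε * μ) * (Complex.exp (-(I * t)) * u t)] with hGdef
  have hVG : ∀ t, HasDerivAt V (G t) t := by
    intro t
    rw [hasDerivAt_pi]
    intro i
    fin_cases i
    · refine ((hE t).mul (hu t)).congr_deriv ?_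
      symm
      simp only [hGdef, Fin.zero_eta, Matrix.cons_val_zero]
      push_cast
      linear_combination (-c * W t 0) * hcancel (I * t)
    · refine ((hE' t).mul (hv t)).congr_deriv ?_
      symm
      simp only [hGdef, Fin.mk_one, Matrix.cons_val_one, Matrix.cons_val_zero]
      push_cast
      linear_combination (-c * W t 1) * hcancel (I * t)
  have hGc : Continuous G := by
    refine continuous_pi fun i => ?_
    fin_cases i
    · simp only [hGdef, Fin.zero_eta, Matrix.cons_val_zero]
      fun_prop
    · simp only [hGdef, Fin.mk_one, Matrix.cons_val_one, Matrix.cons_val_zero]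
      fun_prop
  have hderiv : deriv V = G := funext fun t => (hVG t).deriv
  refine ⟨V, ?_, ?_, ?_⟩
  · rw [contDiff_one_iff_deriv, hderiv]
    exact ⟨fun t => (hVG t).differentiableAt, hGc⟩
  · intro t
    simp only [hVdef, hexp t, hexp' t, huT t, hvT t]
  · intro t
    have hε0 : (ε : ℂ) ≠ 0 := by exact_mod_cast hε.ne'
    have hΔ0 : (Δt : ℂ) ≠ 0 := by exact_mod_cast hΔt.ne'
    have h2 : Complex.exp (2 * I * t) * Complex.exp (-(I * t)) = Complex.exp (I * t) := by
      rw [← Complex.exp_add]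
      ring_nf
    have h2' : Complex.exp (-2 * I * t) * Complex.exp (I * t) = Complex.exp (-(I * t)) := by
      rw [← Complex.exp_add]
      ring_nf
    ext i
    fin_cases i
    · refine (Qop_apply_zero ε Δt μ V t).trans ?_
      rw [hderiv]
      simp only [hVdef, hGdef, hc, Fin.zero_eta, Matrix.cons_val_zero,
        Matrix.cons_val_one]
      rw [← mul_assoc (Complex.exp (2 * I * t)), h2]
      push_cast
      field_simp
      ring
    · refine (Qop_apply_one ε Δt μ V t).trans ?_
      rw [hderiv]
      simp only [hVdef, hGdef, hc, Fin.mk_one, Matrix.cons_val_zero,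
        Matrix.cons_val_one]
      rw [← mul_assoc (Complex.exp (-2 * I * t)), h2']
      push_cast
      field_simp
      ring

/-- The operator `Q` is invertible on `2π`-periodic functions:
for every continuous `2π`-periodic `W` there is a unique `C¹`, `2π`-periodic `V`
with `Q(V) = W`, and any such `V` obeys the a priori bound
`sup_τ ‖V(τ)‖ ≤ sup_τ ‖W(τ)‖`. -/
theorem stmt_16 (ε Δt : ℝ) (hε : 0 < ε) (hΔt : 0 < Δt) (μ : ℝ)
    (W : ℝ → Fin 2 → ℂ) (hWc : Continuous W) (hWper : Function.Periodic W (2 * π)) :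
    (∃! V : ℝ → Fin 2 → ℂ,
      ContDiff ℝ 1 V ∧ Function.Periodic V (2 * π) ∧ ∀ τ : ℝ, Qop ε Δt μ V τ = W τ) ∧
    (∀ V : ℝ → Fin 2 → ℂ,
      ContDiff ℝ 1 V → Function.Periodic V (2 * π) → (∀ τ : ℝ, Qop ε Δt μ V τ = W τ) →
      ∀ τ : ℝ,
        enorm2 (V τ) ≤ sSup ((fun s => enorm2 (W s)) '' Set.Icc 0 (2 * π))) := by
  refine ⟨?_, fun V hV hVper hQ τ =>
    enorm2_le_sSup_enorm2_Qop hWc (hV.differentiable one_ne_zero) hVper hQ τ⟩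
  obtain ⟨V, hV, hVper, hQ⟩ := exists_periodic_Qop_eq hε hΔt μ hWc hWper
  refine ⟨V, ⟨hV, hVper, hQ⟩, fun V' ⟨hV', hVper', hQ'⟩ => ?_⟩
  have hd := hV.differentiable one_ne_zero
  have hd' := hV'.differentiable one_ne_zero
  have hQ0 : ∀ τ, Qop ε Δt μ (V' - V) τ = (fun _ => 0 : ℝ → Fin 2 → ℂ) τ := fun τ => by
    rw [Qop_sub ε Δt μ (hd' τ) (hd τ), hQ, hQ', sub_self]
  refine sub_eq_zero.mp (funext fun τ => eq_zero_of_enorm2_le_zero ?_)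
  have h := enorm2_le_sSup_enorm2_Qop continuous_const (hd'.sub hd) (hVper'.sub hVper) hQ0 τ
  rw [(Set.nonempty_Icc.mpr Real.two_pi_pos.le).image_const, csSup_singleton] at h
  simpa [enorm2] using h
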